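/- arXiv:0909.0982 — 2 statements merged into one kernel-verified Lean document; each statement's English description precedes it below -/
import Mathlib

section
/- Let X₁ and X₂ be zero-dimensional Hausdorff spaces, and for i = 1, 2 let fᵢ : Xᵢ → Yᵢ be a topological embedding with dense image into a zero-dimensional locally compact Hausdorff space Yᵢ; set Aᵢ = {fᵢ⁻¹(G) : G clopen in Yᵢ} and Iᵢ = {fᵢ⁻¹(G) : G compact clopen in Yᵢ}. Let f : X₁ → X₂ satisfy (ZEQ1): for every G ∈ A₂, f⁻¹(G) ∈ A₁, and (ZEQ2): for every F ∈ I₁ there exists G ∈ I₂ with f(F) ⊆ G, and let g : Y₁ → Y₂ be a continuous map with g ∘ f₁ = f₂ ∘ f. Then g is a perfect map (i.e. a closed continuous map such that the preimage of every point is compact) if and only if for every G ∈ I₂, f⁻¹(G) ∈ I₁. -/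
open Topology TopologicalSpace Set

/-- In a locally compact space with a base of clopen sets, every compact set is contained in a
compact clopen set. -/
theorem IsCompact.exists_isClopen_isCompact_superset {Y : Type*} [TopologicalSpace Y]
    [LocallyCompactSpace Y] (hY : IsTopologicalBasis {s : Set Y | IsClopen s})
    {K : Set Y} (hK : IsCompact K) : ∃ G : Set Y, IsClopen G ∧ IsCompact G ∧ K ⊆ G := by
  refine hK.induction_on ⟨∅, isClopen_empty, isCompact_empty, Subset.rfl⟩ ?_ ?_ ?_
  · rintro s t hst ⟨G, hG, hGc, htG⟩
    exact ⟨G, hG, hGc, hst.trans htG⟩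
  · rintro s t ⟨G, hG, hGc, hsG⟩ ⟨H, hH, hHc, htH⟩
    exact ⟨G ∪ H, hG.union hH, hGc.union hHc, union_subset_union hsG htH⟩
  · intro y _
    obtain ⟨L, hL, hyL⟩ := exists_compact_mem_nhds y
    obtain ⟨G, hG, hyG, hGL⟩ := hY.mem_nhds_iff.1 hyL
    exact ⟨G, mem_nhdsWithin_of_mem_nhds (hG.isOpen.mem_nhds hyG), G, hG,
      hL.of_isClosed_subset hG.isClosed hGL, Subset.rfl⟩

/-- A clopen set is determined by its preimage under a map with dense range. -/
theorem DenseRange.eq_of_preimage_eq_of_isClopen {X Y : Type*} [TopologicalSpace Y] {f : X → Y}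
    (hf : DenseRange f) {G H : Set Y} (hG : IsClopen G) (hH : IsClopen H)
    (h : f ⁻¹' G = f ⁻¹' H) : G = H := by
  have key : ∀ {G H : Set Y}, IsClopen G → IsClopen H → f ⁻¹' G = f ⁻¹' H → G ⊆ H := by
    intro G H hG hH h y hy
    by_contra hyH
    obtain ⟨x, hxG, hxH⟩ := hf.exists_mem_open (hG.isOpen.inter hH.compl.isOpen) ⟨y, hy, hyH⟩
    exact hxH (h.subset hxG)
  exact (key hG hH h).antisymm (key hH hG h.symm)

theorem stmt14 {X₁ X₂ Y₁ Y₂ : Type*}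
    [TopologicalSpace X₁] [T2Space X₁]
    (hX₁ : IsTopologicalBasis {s : Set X₁ | IsClopen s})
    [TopologicalSpace X₂] [T2Space X₂]
    (hX₂ : IsTopologicalBasis {s : Set X₂ | IsClopen s})
    [TopologicalSpace Y₁] [T2Space Y₁] [LocallyCompactSpace Y₁]
    (hY₁ : IsTopologicalBasis {s : Set Y₁ | IsClopen s})
    [TopologicalSpace Y₂] [T2Space Y₂] [LocallyCompactSpace Y₂]
    (hY₂ : IsTopologicalBasis {s : Set Y₂ | IsClopen s})
    (f₁ : X₁ → Y₁) (hf₁ : IsEmbedding f₁) (hd₁ : DenseRange f₁)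
    (f₂ : X₂ → Y₂) (hf₂ : IsEmbedding f₂) (hd₂ : DenseRange f₂)
    (A₁ I₁ : Set (Set X₁)) (A₂ I₂ : Set (Set X₂))
    (hA₁ : A₁ = {S : Set X₁ | ∃ G : Set Y₁, IsClopen G ∧ S = f₁ ⁻¹' G})
    (hI₁ : I₁ = {S : Set X₁ | ∃ G : Set Y₁, IsClopen G ∧ IsCompact G ∧ S = f₁ ⁻¹' G})
    (hA₂ : A₂ = {S : Set X₂ | ∃ G : Set Y₂, IsClopen G ∧ S = f₂ ⁻¹' G})
    (hI₂ : I₂ = {S : Set X₂ | ∃ G : Set Y₂, IsClopen G ∧ IsCompact G ∧ S = f₂ ⁻¹' G})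
    (f : X₁ → X₂)
    (hZEQ1 : ∀ G ∈ A₂, f ⁻¹' G ∈ A₁)
    (hZEQ2 : ∀ F ∈ I₁, ∃ G ∈ I₂, f '' F ⊆ G)
    (g : Y₁ → Y₂) (hg : Continuous g) (hcomm : ∀ x : X₁, g (f₁ x) = f₂ (f x))
    :
    (IsClosedMap g ∧ ∀ y : Y₂, IsCompact (g ⁻¹' {y})) ↔ ∀ G ∈ I₂, f ⁻¹' G ∈ I₁ := by
  subst hI₁ hI₂
  have hpre : ∀ G : Set Y₂, f ⁻¹' (f₂ ⁻¹' G) = f₁ ⁻¹' (g ⁻¹' G) := fun G => by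
    ext x
    simp [hcomm]
  constructor
  · rintro ⟨hcl, hfib⟩ _ ⟨G, hG, hGc, rfl⟩
    have hproper : IsProperMap g :=
      isProperMap_iff_isClosedMap_and_compact_fibers.2 ⟨hg, hcl, fun {y} => hfib y⟩
    exact ⟨g ⁻¹' G, hG.preimage hg, hproper.isCompact_preimage hGc, hpre G⟩
  · intro h
    have hproper : IsProperMap g := by
      refine isProperMap_iff_isCompact_preimage.2 ⟨hg, fun {K} hK => ?_⟩
      obtain ⟨G, hG, hGc, hKG⟩ := hK.exists_isClopen_isCompact_superset hY₂
      obtain ⟨H, hH, hHc, hGH⟩ := h _ ⟨G, hG, hGc, rfl⟩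
      obtain rfl : g ⁻¹' G = H :=
        hd₁.eq_of_preimage_eq_of_isClopen (hG.preimage hg) hH ((hpre G).symm.trans hGH)
      exact hHc.of_isClosed_subset (hK.isClosed.preimage hg) (preimage_mono hKG)
    exact ⟨hproper.isClosedMap, fun y => hproper.isCompact_preimage isCompact_singleton⟩
end

section
/- Let X₁ and X₂ be zero-dimensional Hausdorff spaces, and for i = 1, 2 let fᵢ : Xᵢ → Yᵢ be a topological embedding with dense image into a zero-dimensional locally compact Hausdorff space Yᵢ; set Aᵢ = {fᵢ⁻¹(G) : G clopen in Yᵢ} and Iᵢ = {fᵢ⁻¹(G) : G compact clopen in Yᵢ}. Let f : X₁ → X₂ satisfy (ZEQ1): for every G ∈ A₂, f⁻¹(G) ∈ A₁, and (ZEQ2): for every F ∈ I₁ there exists G ∈ I₂ with f(F) ⊆ G, and let g : Y₁ → Y₂ be a continuous map with g ∘ f₁ = f₂ ∘ f. Then g is a topological embedding with dense image if and only if f(X₁) is dense in X₂ and I₁ ⊆ {f⁻¹(G) : G ∈ I₂}. -/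
open Topology TopologicalSpace Set

/-- In a locally compact space with a base of clopen sets, every compact subset of an open set can
be separated from the complement by a compact clopen set. -/
theorem exists_isClopen_isCompact_between {Y : Type*} [TopologicalSpace Y] [T2Space Y]
    [LocallyCompactSpace Y] (hY : IsTopologicalBasis {s : Set Y | IsClopen s})
    {K U : Set Y} (hK : IsCompact K) (hU : IsOpen U) (hKU : K ⊆ U) :
    ∃ G : Set Y, IsClopen G ∧ IsCompact G ∧ K ⊆ G ∧ G ⊆ U := by
  obtain ⟨L, hL, hKL, hLU⟩ := exists_compact_between hK hU hKU
  have key : ∃ G : Set Y, IsClopen G ∧ K ⊆ G ∧ G ⊆ L := by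
    refine hK.induction_on (p := fun S => ∃ G : Set Y, IsClopen G ∧ S ⊆ G ∧ G ⊆ L)
      ⟨∅, isClopen_empty, subset_rfl, empty_subset _⟩ ?_ ?_ ?_
    · rintro s t hst ⟨G, hG, htG, hGL⟩
      exact ⟨G, hG, hst.trans htG, hGL⟩
    · rintro s t ⟨G, hG, hsG, hGL⟩ ⟨H, hH, htH, hHL⟩
      exact ⟨G ∪ H, hG.union hH, union_subset_union hsG htH, union_subset hGL hHL⟩
    · intro x hx
      obtain ⟨G, hG, hxG, hGL⟩ := hY.exists_subset_of_mem_open (hKL hx) isOpen_interior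
      exact ⟨G, mem_nhdsWithin_of_mem_nhds (hG.isOpen.mem_nhds hxG), G, hG, subset_rfl,
        hGL.trans interior_subset⟩
  obtain ⟨G, hG, hKG, hGL⟩ := key
  exact ⟨G, hG, hL.of_isClosed_subset hG.isClosed hGL, hKG, hGL.trans hLU⟩

/-- Clopen sets with the same preimage under a map with dense range are equal. -/
theorem DenseRange.isClopen_eq_of_preimage_eq {X Y : Type*} [TopologicalSpace Y] {e : X → Y}
    (he : DenseRange e) {F G : Set Y} (hF : IsClopen F) (hG : IsClopen G)
    (h : e ⁻¹' F = e ⁻¹' G) : F = G := by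
  have aux : ∀ {F G : Set Y}, IsClopen F → IsClopen G → e ⁻¹' F = e ⁻¹' G → F ⊆ G := by
    intro F G hF hG h y hyF
    by_contra hyG
    obtain ⟨x, hxF, hxG⟩ :=
      he.exists_mem_open (hF.isOpen.inter hG.compl.isOpen) ⟨y, hyF, hyG⟩
    exact hxG (h.subset hxF)
  exact (aux hF hG h).antisymm (aux hG hF h.symm)

theorem stmt17 {X₁ X₂ Y₁ Y₂ : Type*}
    [TopologicalSpace X₁] [T2Space X₁]
    (hX₁ : IsTopologicalBasis {s : Set X₁ | IsClopen s})
    [TopologicalSpace X₂] [T2Space X₂]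
    (hX₂ : IsTopologicalBasis {s : Set X₂ | IsClopen s})
    [TopologicalSpace Y₁] [T2Space Y₁] [LocallyCompactSpace Y₁]
    (hY₁ : IsTopologicalBasis {s : Set Y₁ | IsClopen s})
    [TopologicalSpace Y₂] [T2Space Y₂] [LocallyCompactSpace Y₂]
    (hY₂ : IsTopologicalBasis {s : Set Y₂ | IsClopen s})
    (f₁ : X₁ → Y₁) (hf₁ : IsEmbedding f₁) (hd₁ : DenseRange f₁)
    (f₂ : X₂ → Y₂) (hf₂ : IsEmbedding f₂) (hd₂ : DenseRange f₂)
    (A₁ I₁ : Set (Set X₁)) (A₂ I₂ : Set (Set X₂))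
    (hA₁ : A₁ = {S : Set X₁ | ∃ G : Set Y₁, IsClopen G ∧ S = f₁ ⁻¹' G})
    (hI₁ : I₁ = {S : Set X₁ | ∃ G : Set Y₁, IsClopen G ∧ IsCompact G ∧ S = f₁ ⁻¹' G})
    (hA₂ : A₂ = {S : Set X₂ | ∃ G : Set Y₂, IsClopen G ∧ S = f₂ ⁻¹' G})
    (hI₂ : I₂ = {S : Set X₂ | ∃ G : Set Y₂, IsClopen G ∧ IsCompact G ∧ S = f₂ ⁻¹' G})
    (f : X₁ → X₂)
    (hZEQ1 : ∀ G ∈ A₂, f ⁻¹' G ∈ A₁)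
    (hZEQ2 : ∀ F ∈ I₁, ∃ G ∈ I₂, f '' F ⊆ G)
    (g : Y₁ → Y₂) (hg : Continuous g) (hcomm : ∀ x : X₁, g (f₁ x) = f₂ (f x))
    :
    (IsEmbedding g ∧ DenseRange g) ↔
      (Dense (Set.range f) ∧ I₁ ⊆ {T : Set X₁ | ∃ G ∈ I₂, T = f ⁻¹' G}) := by
  subst hI₁ hI₂
  have hrange : Set.range (f₂ ∘ f) ⊆ Set.range g := by
    rintro _ ⟨x, rfl⟩
    exact ⟨f₁ x, hcomm x⟩
  have hpre : ∀ G : Set Y₂, f ⁻¹' (f₂ ⁻¹' G) = f₁ ⁻¹' (g ⁻¹' G) := fun G => by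
    ext x
    simp only [mem_preimage, hcomm]
  constructor
  · rintro ⟨hge, hgd⟩
    refine ⟨fun x => ?_, ?_⟩
    · have hd : DenseRange (f₂ ∘ f) := by
        rw [← (funext hcomm : g ∘ f₁ = f₂ ∘ f)]
        exact hgd.comp hd₁ hg
      rw [hf₂.isInducing.closure_eq_preimage_closure_image, ← range_comp]
      exact hd (f₂ x)
    · rintro _ ⟨F, hF, hFc, rfl⟩
      obtain ⟨U, hU, hUF⟩ := hge.isInducing.isOpen_iff.1 hF.isOpen
      obtain ⟨G, hG, hGc, hFG, hGU⟩ := exists_isClopen_isCompact_between hY₂ (hFc.image hg) hU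
        (image_subset_iff.2 hUF.ge)
      refine ⟨_, ⟨G, hG, hGc, rfl⟩, ?_⟩
      rw [hpre, (image_subset_iff.1 hFG).antisymm ((preimage_mono hGU).trans hUF.le)]
  · rintro ⟨hfd, hI⟩
    have hfd' : DenseRange f := hfd
    refine ⟨IsInducing.isEmbedding (isInducing_iff_nhds.2 fun y => ?_),
      (hd₂.comp hfd' hf₂.continuous).mono hrange⟩
    refine le_antisymm hg.continuousAt.le_comap fun V hV => ?_
    obtain ⟨U, hUV, hU, hyU⟩ := mem_nhds_iff.1 hV
    obtain ⟨F, hF, hFc, hyF, hFU⟩ := exists_isClopen_isCompact_between hY₁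
      isCompact_singleton hU (singleton_subset_iff.2 hyU)
    obtain ⟨_, ⟨G, hG, -, rfl⟩, hFG⟩ := hI ⟨F, hF, hFc, rfl⟩
    rw [hpre] at hFG
    have hFG' := hd₁.isClopen_eq_of_preimage_eq hF (hG.preimage hg) hFG
    have hyG : g y ∈ G := hFG'.subset (singleton_subset_iff.1 hyF)
    exact ⟨G, hG.isOpen.mem_nhds hyG, hFG'.ge.trans (hFU.trans hUV)⟩
end
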